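/- Let x ∈ Σ be a sequence that is not eventually constant and suppose liminf_{n→∞} e^{S_nχ(x)} = 0 and limsup_{n→∞} e^{S_nχ(x)} = ∞. Then Θ'(ξ) does not exist in the generalised sense at ξ := π_S(x), i.e. the limit lim_{η→ξ} D_Θ(ξ,η) neither exists as a finite real number nor equals +∞. -/

import Mathlib

open Set Filter Topology

noncomputable section

/-- The unit interval `𝒰 = [0,1]`. -/
abbrev UI : Set ℝ := Set.Icc 0 1

/-- An expanding piecewise `C^{1+ε}` map of the unit interval, presented through its
`d` increasing full inverse branches (ordered left to right, images covering `𝒰` with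
pairwise disjoint interiors), each branch being a `C^{1+ε}` diffeomorphism onto its image
whose derivative is `ε`-Hölder continuous with values in `(0,1)`. -/
structure ExpMap (d : ℕ) (ε : ℝ) : Type where
  toFun : ℝ → ℝ
  branch : Fin d → ℝ → ℝ
  branchDeriv : Fin d → ℝ → ℝ
  maps_to : Set.MapsTo toFun UI UI
  branch_maps_to : ∀ a, Set.MapsTo (branch a) UI UI
  branch_mono : ∀ a, StrictMonoOn (branch a) UI
  right_inv : ∀ a, ∀ ξ ∈ Set.Ico (0 : ℝ) 1, toFun (branch a ξ) = ξ
  map_one : toFun 1 = 1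
  branch_hasDeriv : ∀ a, ∀ ξ ∈ UI, HasDerivWithinAt (branch a) (branchDeriv a ξ) UI ξ
  branchDeriv_mem : ∀ a, ∀ ξ ∈ UI, branchDeriv a ξ ∈ Set.Ioo (0 : ℝ) 1
  branchDeriv_holder : ∀ a, ∃ C > 0, ∀ ξ ∈ UI, ∀ η ∈ UI,
      |branchDeriv a ξ - branchDeriv a η| ≤ C * |ξ - η| ^ ε
  ordered : ∀ a b : Fin d, a < b → ∀ ξ ∈ UI, ∀ η ∈ UI, branch a ξ ≤ branch b η
  cover : UI ⊆ ⋃ a, branch a '' UI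

/-- The shift map on `Σ = {1,…,d}^ℕ` (`x n` represents the letter `x_{n+1}`). -/
def shift {d : ℕ} (x : ℕ → Fin d) : ℕ → Fin d := fun n => x (n + 1)

/-- The cylinder set `[x_1 … x_n]`. -/
def cyl {d : ℕ} (x : ℕ → Fin d) (n : ℕ) : Set (ℕ → Fin d) := {y | ∀ m < n, y m = x m}

/-- Finite approximations `S_{x_1}^{-1} ∘ ⋯ ∘ S_{x_n}^{-1}(0)` to the coding map. -/
def approx {d : ℕ} {ε : ℝ} (S : ExpMap d ε) (x : ℕ → Fin d) (n : ℕ) : ℝ :=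
  (List.range n).foldr (fun m ξ => S.branch (x m) ξ) 0

/-- The coding map `π_S : Σ → 𝒰`. -/
def proj {d : ℕ} {ε : ℝ} (S : ExpMap d ε) (x : ℕ → Fin d) : ℝ := ⨆ n, approx S x n

/-- The potential `φ(x) = log (S_{x_1}^{-1})'(π_S(σ x))` associated with `S`. -/
def pot {d : ℕ} {ε : ℝ} (S : ExpMap d ε) (x : ℕ → Fin d) : ℝ :=
  Real.log (S.branchDeriv (x 0) (proj S (shift x)))

/-- Birkhoff sums `S_n f(x) = ∑_{m=0}^{n-1} f(σ^m x)`. -/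
def birk {d : ℕ} (f : (ℕ → Fin d) → ℝ) (n : ℕ) (x : ℕ → Fin d) : ℝ :=
  ∑ m ∈ Finset.range n, f (shift^[m] x)

/-- The difference quotient `D_Θ(ξ, η) = (Θ(ξ) - Θ(η))/(ξ - η)`. -/
def DQ (Θ : ℝ → ℝ) (ξ η : ℝ) : ℝ := (Θ ξ - Θ η) / (ξ - η)

/-- `Θ` is the conjugacy between `S` and `T` : an increasing homeomorphism of `𝒰`
with `T ∘ Θ = Θ ∘ S`. -/
def IsConjugacy {d : ℕ} {ε : ℝ} (S T : ExpMap d ε) (Θ : ℝ → ℝ) : Prop :=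
  StrictMonoOn Θ UI ∧ ContinuousOn Θ UI ∧ Θ '' UI = UI ∧
    ∀ ξ ∈ UI, T.toFun (Θ ξ) = Θ (S.toFun ξ)

/-- `x` has an `i`-block of length `k` at the `n`-th level:
`x_{n+1} = ⋯ = x_{n+k} = i` and `x_{n+k+1} ≠ i`. -/
def HasBlock {d : ℕ} (x : ℕ → Fin d) (i : Fin d) (k n : ℕ) : Prop :=
  (∀ m < k, x (n + m) = i) ∧ x (n + k) ≠ i

/-- `x` is eventually constant. -/
def EvConst {d : ℕ} (x : ℕ → Fin d) : Prop := ∃ N : ℕ, ∃ i : Fin d, ∀ n ≥ N, x n = i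

/-- `Θ'(ξ)` exists in the generalised sense: `lim_{η→ξ} D_Θ(ξ,η)` exists in `[0,∞]`
(with one-sided limits at the boundary points). -/
def GenDeriv (Θ : ℝ → ℝ) (ξ : ℝ) : Prop :=
  (∃ L : ℝ, Filter.Tendsto (fun η => DQ Θ ξ η) (nhdsWithin ξ (UI \ {ξ})) (nhds L)) ∨
    Filter.Tendsto (fun η => DQ Θ ξ η) (nhdsWithin ξ (UI \ {ξ})) Filter.atTop

namespace ExpMap

variable {d : ℕ} {ε : ℝ} (S T : ExpMap d ε)

lemma branch_continuousOn (a : Fin d) : ContinuousOn (S.branch a) UI :=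
  fun ξ hξ => (S.branch_hasDeriv a ξ hξ).continuousWithinAt

lemma branchDeriv_continuousOn (hε : 0 < ε) (a : Fin d) : ContinuousOn (S.branchDeriv a) UI := by
  obtain ⟨C, hC, h⟩ := S.branchDeriv_holder a
  intro ξ hξ
  have hlim : Tendsto (fun η => C * |η - ξ| ^ ε) (𝓝[UI] ξ) (𝓝 0) := by
    have hc : Continuous fun η : ℝ => C * |η - ξ| ^ ε :=
      continuous_const.mul ((continuous_id.sub continuous_const).abs.rpow_const
        fun _ => Or.inr hε.le)
    have := (hc.tendsto ξ).mono_left (nhdsWithin_le_nhds (s := UI))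
    simpa [Real.zero_rpow hε.ne'] using this
  refine tendsto_iff_dist_tendsto_zero.2 (squeeze_zero' (Eventually.of_forall fun _ => dist_nonneg)
    ?_ hlim)
  filter_upwards [self_mem_nhdsWithin] with η hη
  exact h η hη ξ hξ

/-- The branch derivatives are uniformly bounded away from `1`. -/
lemma exists_branchDeriv_le (hε : 0 < ε) :
    ∃ l : ℝ, 0 < l ∧ l < 1 ∧ ∀ a, ∀ ξ ∈ UI, S.branchDeriv a ξ ≤ l := by
  have hmax : ∀ a, ∃ l : ℝ, l < 1 ∧ ∀ ξ ∈ UI, S.branchDeriv a ξ ≤ l := fun a => by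
    obtain ⟨ζ, hζ, h⟩ := isCompact_Icc.exists_isMaxOn (nonempty_Icc.2 zero_le_one)
      (S.branchDeriv_continuousOn hε a)
    exact ⟨_, (S.branchDeriv_mem a ζ hζ).2, fun ξ hξ => h hξ⟩
  choose l hl h using hmax
  rcases isEmpty_or_nonempty (Fin d) with he | hne
  · exact ⟨1 / 2, by norm_num, by norm_num, fun a => isEmptyElim a⟩
  · obtain ⟨b, hb⟩ := Finite.exists_max l
    have h0 : (0 : ℝ) ∈ UI := ⟨le_rfl, zero_le_one⟩
    exact ⟨l b, (S.branchDeriv_mem b 0 h0).1.trans_le (h b 0 h0), hl b,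
      fun a ξ hξ => (h a ξ hξ).trans (hb a)⟩

lemma exists_abs_log_sub_le (hε : 0 < ε) :
    ∃ C : ℝ, 0 ≤ C ∧ ∀ a, ∀ ξ ∈ UI, ∀ η ∈ UI,
      |Real.log (S.branchDeriv a ξ) - Real.log (S.branchDeriv a η)| ≤ C * |ξ - η| ^ ε := by
  have hloc : ∀ a, ∃ C : ℝ, 0 ≤ C ∧ ∀ ξ ∈ UI, ∀ η ∈ UI,
      |Real.log (S.branchDeriv a ξ) - Real.log (S.branchDeriv a η)| ≤ C * |ξ - η| ^ ε := by
    intro a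
    obtain ⟨C, hC, h⟩ := S.branchDeriv_holder a
    obtain ⟨ζ, hζ, hmin⟩ := isCompact_Icc.exists_isMinOn (nonempty_Icc.2 zero_le_one)
      (S.branchDeriv_continuousOn hε a)
    set m := S.branchDeriv a ζ with hm_def
    have hm : 0 < m := (S.branchDeriv_mem a ζ hζ).1
    have key : ∀ ξ ∈ UI, ∀ η ∈ UI,
        Real.log (S.branchDeriv a ξ) - Real.log (S.branchDeriv a η) ≤ C / m * |ξ - η| ^ ε := by
      intro ξ hξ η hη
      have h1 := (S.branchDeriv_mem a ξ hξ).1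
      have h2 := (S.branchDeriv_mem a η hη).1
      have h3 : m ≤ S.branchDeriv a η := hmin hη
      rw [← Real.log_div h1.ne' h2.ne']
      calc Real.log (S.branchDeriv a ξ / S.branchDeriv a η)
          ≤ S.branchDeriv a ξ / S.branchDeriv a η - 1 := Real.log_le_sub_one_of_pos (by positivity)
        _ = (S.branchDeriv a ξ - S.branchDeriv a η) / S.branchDeriv a η := by field_simp
        _ ≤ C * |ξ - η| ^ ε / S.branchDeriv a η := by
            gcongr
            exact (le_abs_self _).trans (h ξ hξ η hη)
        _ ≤ C * |ξ - η| ^ ε / m := by gcongr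
        _ = C / m * |ξ - η| ^ ε := by ring
    refine ⟨C / m, by positivity, fun ξ hξ η hη => abs_sub_le_iff.2 ⟨key ξ hξ η hη, ?_⟩⟩
    rw [abs_sub_comm]
    exact key η hη ξ hξ
  choose C hC h using hloc
  refine ⟨∑ a, C a, Finset.sum_nonneg fun a _ => hC a, fun a ξ hξ η hη => ?_⟩
  refine (h a ξ hξ η hη).trans ?_
  gcongr
  exact Finset.single_le_sum (fun b _ => hC b) (Finset.mem_univ a)

/-- The composition `S_{x_1}^{-1} ∘ ⋯ ∘ S_{x_n}^{-1}`. -/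
def word : (ℕ → Fin d) → ℕ → ℝ → ℝ
  | _, 0, t => t
  | x, n + 1, t => S.branch (x 0) (word (shift x) n t)

lemma word_mem (x : ℕ → Fin d) (n : ℕ) {t : ℝ} (ht : t ∈ UI) : S.word x n t ∈ UI := by
  induction n generalizing x with
  | zero => exact ht
  | succ n ih => exact S.branch_maps_to _ (ih _)

lemma word_strictMonoOn (x : ℕ → Fin d) (n : ℕ) : StrictMonoOn (S.word x n) UI := by
  induction n generalizing x with
  | zero => exact fun _ _ _ _ h => h
  | succ n ih =>
    exact fun s hs t ht h => S.branch_mono _ (S.word_mem _ n hs) (S.word_mem _ n ht) (ih _ hs ht h)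

lemma approx_eq_word (x : ℕ → Fin d) (n : ℕ) : approx S x n = S.word x n 0 := by
  induction n generalizing x with
  | zero => rfl
  | succ n ih =>
    rw [word, ← ih]
    simp [approx, List.range_succ_eq_map, List.foldr_map, shift]

lemma approx_mem (x : ℕ → Fin d) (n : ℕ) : approx S x n ∈ UI := by
  rw [approx_eq_word]
  exact S.word_mem x n ⟨le_rfl, zero_le_one⟩

lemma approx_mono (x : ℕ → Fin d) : Monotone (approx S x) := by
  refine monotone_nat_of_le_succ fun n => ?_
  have h0 : (0 : ℝ) ∈ UI := ⟨le_rfl, zero_le_one⟩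
  simp only [approx_eq_word]
  induction n generalizing x with
  | zero => exact (S.word_mem x 1 h0).1
  | succ n ih =>
    exact (S.branch_mono _).monotoneOn (S.word_mem _ n h0) (S.word_mem _ (n + 1) h0) (ih _)

lemma tendsto_approx (x : ℕ → Fin d) : Tendsto (approx S x) atTop (𝓝 (proj S x)) :=
  tendsto_atTop_ciSup (S.approx_mono x) ⟨1, by rintro _ ⟨n, rfl⟩; exact (S.approx_mem x n).2⟩

lemma proj_mem (x : ℕ → Fin d) : proj S x ∈ UI :=
  isClosed_Icc.mem_of_tendsto (S.tendsto_approx x) (Eventually.of_forall (S.approx_mem x))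

lemma proj_eq (x : ℕ → Fin d) : proj S x = S.branch (x 0) (proj S (shift x)) := by
  refine tendsto_nhds_unique ((tendsto_add_atTop_iff_nat 1).2 (S.tendsto_approx x)) ?_
  have h := (S.branch_continuousOn (x 0) _ (S.proj_mem (shift x))).tendsto.comp
    (tendsto_nhdsWithin_iff.2 ⟨S.tendsto_approx (shift x),
      Eventually.of_forall (S.approx_mem (shift x))⟩)
  refine h.congr fun n => ?_
  simp [approx_eq_word, word]

lemma proj_mem_word (x : ℕ → Fin d) (n : ℕ) :
    proj S x ∈ Icc (S.word x n 0) (S.word x n 1) := by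
  induction n generalizing x with
  | zero => exact S.proj_mem x
  | succ n ih =>
    have h0 : (0 : ℝ) ∈ UI := ⟨le_rfl, zero_le_one⟩
    have h1 : (1 : ℝ) ∈ UI := ⟨zero_le_one, le_rfl⟩
    rw [proj_eq]
    exact ⟨(S.branch_mono _).monotoneOn (S.word_mem _ n h0) (S.proj_mem _) (ih _).1,
      (S.branch_mono _).monotoneOn (S.proj_mem _) (S.word_mem _ n h1) (ih _).2⟩

/-- The length of the `n`-th cylinder interval around `proj S x`. -/
def cylLength (x : ℕ → Fin d) (n : ℕ) : ℝ := S.word x n 1 - S.word x n 0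

lemma cylLength_pos (x : ℕ → Fin d) (n : ℕ) : 0 < S.cylLength x n :=
  sub_pos.2 (S.word_strictMonoOn x n ⟨le_rfl, zero_le_one⟩ ⟨zero_le_one, le_rfl⟩ one_pos)

lemma exists_cylLength_succ (x : ℕ → Fin d) (n : ℕ) :
    ∃ c ∈ Icc (S.word (shift x) n 0) (S.word (shift x) n 1),
      S.cylLength x (n + 1) = S.branchDeriv (x 0) c * S.cylLength (shift x) n := by
  have h0 := S.word_mem (shift x) n (t := 0) ⟨le_rfl, zero_le_one⟩
  have h1 := S.word_mem (shift x) n (t := 1) ⟨zero_le_one, le_rfl⟩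
  have hpos := S.cylLength_pos (shift x) n
  have hsub : Icc (S.word (shift x) n 0) (S.word (shift x) n 1) ⊆ UI := Icc_subset_Icc h0.1 h1.2
  obtain ⟨c, hc, h⟩ := exists_hasDerivAt_eq_slope (S.branch (x 0)) (S.branchDeriv (x 0))
    (sub_pos.1 hpos) ((S.branch_continuousOn _).mono hsub) fun ξ hξ =>
      (S.branch_hasDeriv _ ξ (hsub (Ioo_subset_Icc_self hξ))).hasDerivAt
        (Icc_mem_nhds (h0.1.trans_lt hξ.1) (hξ.2.trans_le h1.2))
  refine ⟨c, Ioo_subset_Icc_self hc, ?_⟩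
  rw [h]
  exact (div_mul_cancel₀ _ hpos.ne').symm

lemma cylLength_le_pow {l : ℝ} (hl : 0 < l) (h : ∀ a, ∀ ξ ∈ UI, S.branchDeriv a ξ ≤ l)
    (x : ℕ → Fin d) (n : ℕ) : S.cylLength x n ≤ l ^ n := by
  induction n generalizing x with
  | zero => simp [cylLength, word]
  | succ n ih =>
    obtain ⟨c, hc, hlen⟩ := S.exists_cylLength_succ x n
    have hc' : c ∈ UI := ⟨(S.word_mem _ n ⟨le_rfl, zero_le_one⟩).1.trans hc.1,
      hc.2.trans (S.word_mem _ n ⟨zero_le_one, le_rfl⟩).2⟩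
    rw [hlen, pow_succ']
    exact mul_le_mul (h _ c hc') (ih _) (S.cylLength_pos _ n).le hl.le

lemma tendsto_cylLength (hε : 0 < ε) (x : ℕ → Fin d) :
    Tendsto (S.cylLength x) atTop (𝓝 0) := by
  obtain ⟨l, hl, hl1, h⟩ := S.exists_branchDeriv_le hε
  exact squeeze_zero (fun n => (S.cylLength_pos x n).le) (S.cylLength_le_pow hl h x)
    (tendsto_pow_atTop_nhds_zero_of_lt_one hl.le hl1)

lemma birk_succ (f : (ℕ → Fin d) → ℝ) (n : ℕ) (x : ℕ → Fin d) :
    birk f (n + 1) x = f x + birk f n (shift x) := by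
  simp [birk, Finset.sum_range_succ', add_comm]

/-- Bounded distortion: cylinder lengths are comparable to exponentials of Birkhoff sums. -/
lemma exists_abs_log_cylLength_sub_birk_le (hε : 0 < ε) :
    ∃ K : ℝ, ∀ x n, |Real.log (S.cylLength x n) - birk (pot S) n x| ≤ K := by
  obtain ⟨l, hl, hl1, hle⟩ := S.exists_branchDeriv_le hε
  obtain ⟨C, hC, hlog⟩ := S.exists_abs_log_sub_le hε
  have hr0 : 0 ≤ l ^ ε := Real.rpow_nonneg hl.le ε
  have hr1 : l ^ ε < 1 := Real.rpow_lt_one hl.le hl1 hε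
  have key : ∀ n x, |Real.log (S.cylLength x n) - birk (pot S) n x| ≤
      ∑ k ∈ Finset.range n, C * (l ^ ε) ^ k := by
    intro n
    induction n with
    | zero => intro x; simp [cylLength, word, birk]
    | succ n ih =>
      intro x
      obtain ⟨c, hc, hlen⟩ := S.exists_cylLength_succ x n
      have hc' : c ∈ UI := ⟨(S.word_mem _ n ⟨le_rfl, zero_le_one⟩).1.trans hc.1,
        hc.2.trans (S.word_mem _ n ⟨zero_le_one, le_rfl⟩).2⟩
      have hp := S.proj_mem_word (shift x) n
      have hdist : |c - proj S (shift x)| ≤ l ^ n := by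
        refine le_trans ?_ (S.cylLength_le_pow hl hle (shift x) n)
        rw [cylLength, abs_le]
        constructor <;> linarith [hc.1, hc.2, hp.1, hp.2]
      have hstep : |Real.log (S.branchDeriv (x 0) c) - pot S x| ≤ C * (l ^ ε) ^ n := by
        refine (hlog (x 0) c hc' _ (S.proj_mem (shift x))).trans ?_
        have : (l ^ ε) ^ n = (l ^ n) ^ ε := by
          rw [← Real.rpow_natCast, ← Real.rpow_natCast, ← Real.rpow_mul hl.le,
            ← Real.rpow_mul hl.le, mul_comm]
        rw [this]
        gcongr
      rw [hlen, Real.log_mul (S.branchDeriv_mem _ c hc').1.ne' (S.cylLength_pos _ n).ne',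
        birk_succ, add_sub_add_comm, Finset.sum_range_succ, add_comm (∑ k ∈ _, _)]
      exact (abs_add_le _ _).trans (add_le_add hstep (ih (shift x)))
  refine ⟨C * (1 - l ^ ε)⁻¹, fun x n => (key n x).trans ?_⟩
  rw [← Finset.mul_sum]
  gcongr
  rw [← tsum_geometric_of_lt_one hr0 hr1]
  exact (summable_geometric_of_lt_one hr0 hr1).sum_le_tsum _ fun k _ => pow_nonneg hr0 k

lemma branch_lt_one (a : Fin d) {t : ℝ} (ht : t ∈ Ico (0 : ℝ) 1) : S.branch a t < 1 :=
  (S.branch_mono a ⟨ht.1, ht.2.le⟩ ⟨zero_le_one, le_rfl⟩ ht.2).trans_le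
    (S.branch_maps_to a ⟨zero_le_one, le_rfl⟩).2

lemma exists_branch_eq {ξ : ℝ} (hξ : ξ ∈ Ico (0 : ℝ) 1) :
    ∃ a, ∃ t ∈ Ico (0 : ℝ) 1, S.branch a t = ξ := by
  have h0 : (0 : ℝ) ∈ UI := ⟨le_rfl, zero_le_one⟩
  have h1 : (1 : ℝ) ∈ UI := ⟨zero_le_one, le_rfl⟩
  have cov : ∀ ζ ∈ UI, ∃ a, ∃ t ∈ UI, S.branch a t = ζ := fun ζ hζ => by
    simpa only [mem_iUnion, mem_image] using S.cover hζ
  have le_right : ∀ b, ∀ t ∈ UI, S.branch b t ≤ S.branch b 1 :=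
    fun b t ht => (S.branch_mono b).monotoneOn ht h1 ht.2
  obtain ⟨a, t, ht, hat⟩ := cov ξ ⟨hξ.1, hξ.2.le⟩
  rcases ht.2.lt_or_eq with hlt | rfl
  · exact ⟨a, t, ⟨ht.1, hlt⟩, hat⟩
  have below : ∀ b ≤ a, ∀ s ∈ UI, S.branch b s ≤ ξ := fun b hb s hs => by
    rcases hb.lt_or_eq with hb | rfl
    · exact (S.ordered b a hb s hs 1 h1).trans hat.le
    · exact (le_right b s hs).trans hat.le
  by_cases hlast : (a : ℕ) + 1 < d
  · set a' : Fin d := ⟨a + 1, hlast⟩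
    have haa' : a < a' := Fin.lt_def.2 (Nat.lt_succ_self _)
    have hle : ξ ≤ S.branch a' 0 := hat ▸ S.ordered a a' haa' 1 h1 0 h0
    rcases hle.lt_or_eq with hlt | heq
    · exfalso
      have hb1 := (S.branch_maps_to a' h0).2
      obtain ⟨b, s, hs, hbs⟩ := cov ((ξ + S.branch a' 0) / 2)
        ⟨by linarith [hξ.1], by linarith [hξ.2]⟩
      rcases le_or_gt b a with hb | hb
      · linarith [below b hb s hs]
      · have hb' : a' ≤ b := Fin.le_def.2 (Nat.succ_le_of_lt (Fin.lt_def.1 hb))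
        have : S.branch a' 0 ≤ S.branch b s := by
          rcases hb'.lt_or_eq with h | h
          · exact S.ordered a' b h 0 h0 s hs
          · rw [h]; exact (S.branch_mono b).monotoneOn h0 hs hs.1
        linarith
    · exact ⟨a', 0, ⟨le_rfl, one_pos⟩, heq.symm⟩
  · exfalso
    obtain ⟨b, s, hs, hbs⟩ := cov 1 h1
    have hb : b ≤ a := Fin.le_def.2 (by omega)
    linarith [below b hb s hs, hξ.2]

lemma branch_zero_strictMono : StrictMono fun a => S.branch a 0 := fun a b hab =>
  (S.branch_mono a ⟨le_rfl, zero_le_one⟩ ⟨zero_le_one, le_rfl⟩ one_pos).trans_le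
    (S.ordered a b hab 1 ⟨zero_le_one, le_rfl⟩ 0 ⟨le_rfl, zero_le_one⟩)

end ExpMap

namespace IsConjugacy

variable {d : ℕ} {ε : ℝ} {S T : ExpMap d ε} {Θ : ℝ → ℝ}

lemma map_mem (h : IsConjugacy S T Θ) {ξ : ℝ} (hξ : ξ ∈ UI) : Θ ξ ∈ UI :=
  h.2.2.1 ▸ mem_image_of_mem Θ hξ

lemma map_zero (h : IsConjugacy S T Θ) : Θ 0 = 0 := by
  have h0 : (0 : ℝ) ∈ UI := ⟨le_rfl, zero_le_one⟩
  obtain ⟨ξ, hξ, hξ0⟩ : (0 : ℝ) ∈ Θ '' UI := h.2.2.1.symm ▸ h0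
  exact le_antisymm (hξ0 ▸ h.1.monotoneOn h0 hξ hξ.1) (h.map_mem h0).1

lemma map_one (h : IsConjugacy S T Θ) : Θ 1 = 1 := by
  have h1 : (1 : ℝ) ∈ UI := ⟨zero_le_one, le_rfl⟩
  obtain ⟨ξ, hξ, hξ1⟩ : (1 : ℝ) ∈ Θ '' UI := h.2.2.1.symm ▸ h1
  exact le_antisymm (h.map_mem h1).2 (hξ1.ge.trans (h.1.monotoneOn hξ h1 hξ.2))

lemma map_mem_Ico (h : IsConjugacy S T Θ) {ξ : ℝ} (hξ : ξ ∈ Ico (0 : ℝ) 1) :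
    Θ ξ ∈ Ico (0 : ℝ) 1 :=
  ⟨(h.map_mem ⟨hξ.1, hξ.2.le⟩).1,
    h.map_one ▸ h.1 ⟨hξ.1, hξ.2.le⟩ ⟨zero_le_one, le_rfl⟩ hξ.2⟩

/-- A point in the `a`-th branch of `S` lies in some branch of `T`, at the conjugate parameter. -/
lemma exists_map_branch (h : IsConjugacy S T Θ) (a : Fin d) {t : ℝ} (ht : t ∈ Ico (0 : ℝ) 1) :
    ∃ b, Θ (S.branch a t) = T.branch b (Θ t) := by
  have hmem := S.branch_maps_to a ⟨ht.1, ht.2.le⟩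
  obtain ⟨b, s, hs, hbs⟩ := T.exists_branch_eq (h.map_mem_Ico ⟨hmem.1, S.branch_lt_one a ht⟩)
  refine ⟨b, ?_⟩
  have := h.2.2.2 _ hmem
  rw [S.right_inv a t ht, ← hbs, T.right_inv b s hs] at this
  rw [← this, hbs]

lemma map_branch_zero (h : IsConjugacy S T Θ) (a : Fin d) :
    Θ (S.branch a 0) = T.branch a 0 := by
  have hex : ∀ a, ∃ b, Θ (S.branch a 0) = T.branch b 0 := fun a => by
    simpa only [h.map_zero] using h.exists_map_branch a (t := 0) ⟨le_rfl, one_pos⟩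
  choose e he using hex
  have h0 : (0 : ℝ) ∈ UI := ⟨le_rfl, zero_le_one⟩
  have hmono : StrictMono e := fun a b hab => by
    have := h.1 (S.branch_maps_to a h0) (S.branch_maps_to b h0) (S.branch_zero_strictMono hab)
    rw [he, he] at this
    exact T.branch_zero_strictMono.lt_iff_lt.1 this
  rw [he, le_antisymm hmono.apply_le hmono.le_apply]

lemma map_branch (h : IsConjugacy S T Θ) (a : Fin d) {t : ℝ} (ht : t ∈ UI) :
    Θ (S.branch a t) = T.branch a (Θ t) := by
  have h0 : (0 : ℝ) ∈ UI := ⟨le_rfl, zero_le_one⟩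
  have h1 : (1 : ℝ) ∈ UI := ⟨zero_le_one, le_rfl⟩
  have hIco : EqOn (fun t => Θ (S.branch a t)) (fun t => T.branch a (Θ t)) (Ico 0 1) := by
    intro t ht
    have ht' : t ∈ UI := ⟨ht.1, ht.2.le⟩
    have hmem := S.branch_maps_to a ht'
    obtain ⟨b, hb⟩ := h.exists_map_branch a ht
    rcases lt_trichotomy b a with hba | rfl | hab
    · have l1 := T.branch_mono b (h.map_mem ht') h1 (h.map_mem_Ico ht).2
      have l2 := T.ordered b a hba 1 h1 0 h0
      have l3 := h.1.monotoneOn (S.branch_maps_to a h0) hmem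
        ((S.branch_mono a).monotoneOn h0 ht' ht.1)
      rw [h.map_branch_zero] at l3
      linarith
    · exact hb
    · have l1 := (T.branch_mono b).monotoneOn h0 (h.map_mem ht') (h.map_mem ht').1
      have l2 := h.1 hmem (S.branch_maps_to b h0)
        ((S.branch_mono a ht' h1 ht.2).trans_le (S.ordered a b hab 1 h1 0 h0))
      rw [h.map_branch_zero] at l2
      linarith
  refine hIco.of_subset_closure (t := UI)
    (h.2.1.comp (S.branch_continuousOn a) (S.branch_maps_to a))
    ((T.branch_continuousOn a).comp h.2.1 fun _ => h.map_mem) Ico_subset_Icc_self ?_ ht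
  rw [closure_Ico zero_ne_one]

lemma map_word (h : IsConjugacy S T Θ) (x : ℕ → Fin d) (n : ℕ) {t : ℝ} (ht : t ∈ UI) :
    Θ (S.word x n t) = T.word x n (Θ t) := by
  induction n generalizing x with
  | zero => rfl
  | succ n ih => rw [ExpMap.word, h.map_branch _ (S.word_mem _ n ht), ih, ExpMap.word]

lemma map_word_sub (h : IsConjugacy S T Θ) (x : ℕ → Fin d) (n : ℕ) :
    Θ (S.word x n 1) - Θ (S.word x n 0) = T.cylLength x n := by
  rw [h.map_word x n ⟨zero_le_one, le_rfl⟩, h.map_word x n ⟨le_rfl, zero_le_one⟩, h.map_one,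
    h.map_zero, ExpMap.cylLength]

end IsConjugacy

lemma exists_abs_log_cylLength_sub_le {d : ℕ} {ε : ℝ} (hε : 0 < ε) (S T : ExpMap d ε) :
    ∃ K : ℝ, ∀ x n, |Real.log (T.cylLength x n / S.cylLength x n) -
      birk (fun z => pot T z - pot S z) n x| ≤ K := by
  obtain ⟨K, hK⟩ := S.exists_abs_log_cylLength_sub_birk_le hε
  obtain ⟨K', hK'⟩ := T.exists_abs_log_cylLength_sub_birk_le hε
  refine ⟨K' + K, fun x n => ?_⟩
  have hb : birk (fun z => pot T z - pot S z) n x = birk (pot T) n x - birk (pot S) n x := by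
    simp [birk, Finset.sum_sub_distrib]
  rw [hb, Real.log_div (T.cylLength_pos x n).ne' (S.cylLength_pos x n).ne', sub_sub_sub_comm]
  exact (abs_sub _ _).trans (add_le_add (hK' x n) (hK x n))

/-- A property of difference quotients holding near `proj S x` holds at the endpoints of all
sufficiently small cylinder intervals that differ from `proj S x`. -/
lemma ExpMap.eventually_endpoints {d : ℕ} {ε : ℝ} (hε : 0 < ε) (S : ExpMap d ε) (x : ℕ → Fin d)
    {P : ℝ → Prop} (hP : ∀ᶠ η in 𝓝[UI \ {proj S x}] proj S x, P η) {t : ℝ} (ht : t ∈ UI) :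
    ∀ᶠ n in atTop, S.word x n t ≠ proj S x → P (S.word x n t) := by
  have hlim : Tendsto (fun n => S.word x n t) atTop (𝓝 (proj S x)) := by
    refine tendsto_iff_dist_tendsto_zero.2 (squeeze_zero (fun _ => dist_nonneg) (fun n => ?_)
      (S.tendsto_cylLength hε x))
    have hp := S.proj_mem_word x n
    have l0 := (S.word_strictMonoOn x n).monotoneOn ⟨le_rfl, zero_le_one⟩ ht ht.1
    have l1 := (S.word_strictMonoOn x n).monotoneOn ht ⟨zero_le_one, le_rfl⟩ ht.2
    rw [Real.dist_eq, cylLength, abs_le]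
    constructor <;> linarith [hp.1, hp.2]
  filter_upwards [hlim.eventually (eventually_nhdsWithin_iff.1 hP)] with n hn hne
  exact hn ⟨S.word_mem x n ht, hne⟩

lemma DQ_neg (Θ : ℝ → ℝ) (ξ η : ℝ) : DQ (fun t => -Θ t) ξ η = -DQ Θ ξ η := by
  simp only [DQ]
  ring

/-- An upper bound for difference quotients at `ξ ∈ [a, b]` bounds the slope across `[a, b]`. -/
lemma sub_le_mul_of_DQ_le {Θ : ℝ → ℝ} {M a b ξ : ℝ} (ha : a ≤ ξ) (hb : ξ ≤ b)
    (hDa : a ≠ ξ → DQ Θ ξ a ≤ M) (hDb : b ≠ ξ → DQ Θ ξ b ≤ M) :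
    Θ b - Θ a ≤ M * (b - a) := by
  have l1 : Θ ξ - Θ a ≤ M * (ξ - a) := by
    rcases ha.eq_or_lt with rfl | h
    · simp
    · exact (div_le_iff₀ (sub_pos.2 h)).1 (hDa h.ne)
  have l2 : Θ b - Θ ξ ≤ M * (b - ξ) := by
    rcases hb.eq_or_lt with rfl | h
    · simp
    · have := hDb h.ne'
      rw [DQ, ← neg_sub (Θ b), ← neg_sub b, neg_div_neg_eq] at this
      exact (div_le_iff₀ (sub_pos.2 h)).1 this
  linarith


/-- Corollary `deri`.  If `x ∈ Σ` is not eventually constant and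
`liminf_n e^{S_nχ(x)} = 0` while `limsup_n e^{S_nχ(x)} = ∞`, then `Θ'` does not exist in
the generalised sense at `ξ := π_S(x)`: the limit `lim_{η→ξ} D_Θ(ξ,η)` neither exists as
a finite real number nor equals `+∞`. -/
theorem statement_4 {d : ℕ} {ε : ℝ} (hd : 2 ≤ d) (hε : 0 < ε)
    (S T : ExpMap d ε) (Θ : ℝ → ℝ) (hΘ : IsConjugacy S T Θ)
    (x : ℕ → Fin d) (hx : ¬ EvConst x)
    (hinf : ∀ e > 0, ∀ N : ℕ, ∃ n ≥ N, Real.exp (birk (fun z => pot T z - pot S z) n x) < e)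
    (hsup : ∀ M : ℝ, ∀ N : ℕ, ∃ n ≥ N, M < Real.exp (birk (fun z => pot T z - pot S z) n x)) :
    ¬ GenDeriv Θ (proj S x) := by
  obtain ⟨K, hK⟩ := exists_abs_log_cylLength_sub_le hε S T
  have h0 : (0 : ℝ) ∈ UI := ⟨le_rfl, zero_le_one⟩
  have h1 : (1 : ℝ) ∈ UI := ⟨zero_le_one, le_rfl⟩
  have hpos : ∀ n, 0 < T.cylLength x n / S.cylLength x n := fun n =>
    div_pos (T.cylLength_pos x n) (S.cylLength_pos x n)
  rintro (⟨L, hL⟩ | hL)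
  · have hev := hL.eventually_le_const (lt_add_one L)
    obtain ⟨N, hN⟩ := eventually_atTop.1
      ((S.eventually_endpoints hε x hev h0).and (S.eventually_endpoints hε x hev h1))
    obtain ⟨n, hn, hlt⟩ := hsup (Real.exp K * (L + 1)) N
    have hp := S.proj_mem_word x n
    have hle := sub_le_mul_of_DQ_le hp.1 hp.2 (hN n hn).1 (hN n hn).2
    rw [hΘ.map_word_sub] at hle
    have hratio : T.cylLength x n / S.cylLength x n ≤ L + 1 :=
      (div_le_iff₀ (S.cylLength_pos x n)).2 hle
    have hexp : Real.exp (birk (fun z => pot T z - pot S z) n x) ≤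
        Real.exp K * (T.cylLength x n / S.cylLength x n) := by
      rw [← Real.exp_log (hpos n), ← Real.exp_add]
      exact Real.exp_le_exp.2 (by linarith [(abs_le.1 (hK x n)).1])
    exact absurd (hexp.trans (mul_le_mul_of_nonneg_left hratio (Real.exp_pos K).le)) hlt.not_ge
  · have hev : ∀ᶠ η in 𝓝[UI \ {proj S x}] proj S x,
        DQ (fun t => -Θ t) (proj S x) η ≤ -1 := by
      filter_upwards [hL.eventually_ge_atTop 1] with η hη
      rw [DQ_neg]
      exact neg_le_neg hη
    obtain ⟨N, hN⟩ := eventually_atTop.1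
      ((S.eventually_endpoints hε x hev h0).and (S.eventually_endpoints hε x hev h1))
    obtain ⟨n, hn, hlt⟩ := hinf (Real.exp (-K)) (Real.exp_pos _) N
    have hp := S.proj_mem_word x n
    have hle := sub_le_mul_of_DQ_le hp.1 hp.2 (hN n hn).1 (hN n hn).2
    have hratio : 1 ≤ T.cylLength x n / S.cylLength x n := by
      rw [one_le_div (S.cylLength_pos x n), ← hΘ.map_word_sub, ExpMap.cylLength]
      linarith
    have hlog := Real.log_nonneg hratio
    exact absurd (Real.exp_le_exp.2 (by linarith [(abs_le.1 (hK x n)).2])) hlt.not_ge
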